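/- arXiv:1711.06941 — 2 statements merged into one kernel-verified Lean document; each statement's English description precedes it below -/
import Mathlib

section
/- For all integers n ≥ 0 and k ≥ 0, μ_{n,k} = 2^k ∑_{j=0}^{k} (−1)^j 2^{−j(j−1)/2} (1 − 2^{j−k})^n/(Q_j Q_{k−j}). -/
open Filter Real

/-- `Q j = ∏_{ℓ=1}^{j} (1 - 2^{-ℓ})`. -/
noncomputable def Q (j : ℕ) : ℝ := ∏ l ∈ Finset.range j, (1 - (2:ℝ)^(-(l:ℤ)-1))

/-- Expected external profile `μ_{n,k}`. -/
noncomputable def mu : ℕ → ℕ → ℝ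
  | n, 0 => if n = 0 then 1 else 0
  | n, k + 1 => (2:ℝ)^((2:ℤ) - (n:ℤ)) *
      ∑ j ∈ Finset.range n, ((n-1).choose j : ℝ) * mu j k

lemma Q_succ' (j : ℕ) : Q (j+1) = Q j * (1 - ((2:ℝ)^(j+1))⁻¹) := by
  unfold Q
  rw [Finset.prod_range_succ]
  congr 2
  rw [← zpow_natCast, ← zpow_neg]
  congr 1
  push_cast
  ring

lemma fac_pos' (j : ℕ) : 0 < (1 - ((2:ℝ)^(j+1))⁻¹) := by
  have h : (1:ℝ) < 2^(j+1) := one_lt_pow₀ (by norm_num) (by omega)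
  have := inv_lt_one_of_one_lt₀ h
  linarith

lemma Q_pos' (j : ℕ) : 0 < Q j := by
  induction j with
  | zero => simp [Q]
  | succ j ih => rw [Q_succ']; exact mul_pos ih (fac_pos' j)

lemma partial_sum' (K J : ℕ) (h : J ≤ K) :
    ∑ j ∈ Finset.range (J+1), (-1:ℝ)^j * ((2:ℝ)^(j.choose 2))⁻¹ / (Q j * Q (K+1-j)) =
      (-1:ℝ)^J * ((2:ℝ)^((J+1).choose 2))⁻¹ /
        (Q J * Q (K-J) * (1 - ((2:ℝ)^(K+1))⁻¹)) := by
  induction J with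
  | zero =>
    have h0 : Q 0 = 1 := by simp [Q]
    simp [Q_succ', h0]
  | succ J ih =>
    rw [Finset.sum_range_succ, ih (by omega)]
    obtain ⟨d, rfl⟩ : ∃ d, K = J + 1 + d := ⟨K - (J+1), by omega⟩
    have e1 : J + 1 + d + 1 - (J+1) = d + 1 := by omega
    have e2 : J + 1 + d - J = d + 1 := by omega
    have e3 : J + 1 + d - (J+1) = d := by omega
    have e4 : (J+1+1).choose 2 = (J+1) + (J+1).choose 2 := by
      rw [Nat.choose_succ_succ' (J+1) 1, Nat.choose_one_right]
    rw [e1, e2, e3, e4, Q_succ' d, Q_succ' J]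
    have a1 := (Q_pos' d).ne'
    have a2 := (Q_pos' J).ne'
    have a3 := (fac_pos' d).ne'
    have a4 := (fac_pos' J).ne'
    have a5 := (fac_pos' (J+1+d)).ne'
    have e5 : ((2:ℝ)^(J+1+d+1))⁻¹ = ((2:ℝ)^(J+1))⁻¹ * ((2:ℝ)^(d+1))⁻¹ := by
      rw [← mul_inv, ← pow_add]; rfl
    have e6 : ((2:ℝ)^(J+1+(J+1).choose 2))⁻¹ =
        ((2:ℝ)^(J+1))⁻¹ * ((2:ℝ)^((J+1).choose 2))⁻¹ := by
      rw [← mul_inv, ← pow_add]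
    rw [e5] at a5
    rw [e5, e6, pow_succ (-1:ℝ) J]
    generalize ((2:ℝ)^(J+1))⁻¹ = x at *
    generalize ((2:ℝ)^(d+1))⁻¹ = y at *
    generalize ((2:ℝ)^((J+1).choose 2))⁻¹ = z at *
    obtain ⟨w, hw⟩ : ∃ w, w = 1 - x * y := ⟨_, rfl⟩
    rw [← hw] at a5 ⊢
    field_simp
    rw [hw]
    ring

lemma full_sum' (K : ℕ) :
    ∑ j ∈ Finset.range (K+1+1), (-1:ℝ)^j * ((2:ℝ)^(j.choose 2))⁻¹ / (Q j * Q (K+1-j)) = 0 := by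
  rw [Finset.sum_range_succ, partial_sum' K K le_rfl, Nat.sub_self, Nat.sub_self, Q_succ' K]
  have h0 : Q 0 = 1 := by simp [Q]
  rw [h0, pow_succ (-1:ℝ) K]
  ring

/-- Closed form: `μ_{n,k} = 2^k ∑_{j=0}^{k} (−1)^j 2^{−j(j−1)/2} (1 − 2^{j−k})^n/(Q_j Q_{k−j})`. -/
theorem mu_closed_form : ∀ n k : ℕ,
    mu n k = (2:ℝ)^k * ∑ j ∈ Finset.range (k+1),
      (-1:ℝ)^j * ((2:ℝ)^(j.choose 2))⁻¹ * (1 - (2:ℝ)^((j:ℤ) - (k:ℤ)))^n /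
        (Q j * Q (k-j)) := by
  intro n k
  induction k generalizing n with
  | zero =>
    rcases n with _ | n <;> simp [mu, Q]
  | succ k ih =>
    rcases n with _ | m
    · have := full_sum' k
      simp only [mu, pow_zero, mul_one, this]
      simp
    · rw [mu]
      simp only [ih, Nat.add_sub_cancel]
      rw [Finset.sum_range_succ _ (k+1)]
      have hz : (1 - (2:ℝ)^(((k+1:ℕ):ℤ) - ((k+1:ℕ):ℤ)))^(m+1) = 0 := by simp
      rw [hz, mul_zero, zero_div, add_zero]
      simp only [Finset.mul_sum]
      rw [Finset.sum_comm]
      refine Finset.sum_congr rfl fun j hj => ?_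
      obtain ⟨d, rfl⟩ : ∃ d, k = j + d :=
        ⟨k - j, by have := Finset.mem_range.1 hj; omega⟩
      have e1 : j + d + 1 - j = d + 1 := by omega
      have e2 : j + d - j = d := by omega
      have e3 : (2:ℝ)^((j:ℤ) - ((j+d+1:ℕ):ℤ)) = ((2:ℝ)^(d+1))⁻¹ := by
        rw [← zpow_natCast, ← zpow_neg]; congr 1; push_cast; ring
      have e4 : (2:ℝ)^((j:ℤ) - ((j+d:ℕ):ℤ)) = 2 * ((2:ℝ)^(d+1))⁻¹ := by
        have : (j:ℤ) - ((j+d:ℕ):ℤ) = -(d:ℤ) := by push_cast; ring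
        rw [this, zpow_neg, zpow_natCast, pow_succ]; field_simp
      have e5 : (2:ℝ)^((2:ℤ) - ((m+1:ℕ):ℤ)) = 2 * ((2:ℝ)^m)⁻¹ := by
        have : (2:ℤ) - ((m+1:ℕ):ℤ) = 1 + -(m:ℤ) := by push_cast; ring
        rw [this, zpow_add₀ (by norm_num), zpow_neg, zpow_natCast, zpow_one]
      rw [e1, e2, e3, e4, e5, Q_succ' d]
      have a3 := (fac_pos' d).ne'
      have a1 := (Q_pos' d).ne'
      have a2 := (Q_pos' j).ne'
      generalize ((2:ℝ)^(d+1))⁻¹ = y at *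
      have hb : ∑ i ∈ Finset.range (m+1), (m.choose i : ℝ) * (1 - 2*y)^i = 2^m * (1-y)^m := by
        rw [← mul_pow, show 2 * (1-y) = (1-2*y) + 1 by ring, add_pow]
        refine Finset.sum_congr rfl fun i _ => ?_
        simp; ring
      calc _ = 2 * ((2:ℝ)^m)⁻¹ * 2^(j+d) * ((-1:ℝ)^j * ((2:ℝ)^(j.choose 2))⁻¹ / (Q j * Q d)) *
            ∑ i ∈ Finset.range (m+1), (m.choose i : ℝ) * (1 - 2*y)^i := by
              rw [Finset.mul_sum]
              refine Finset.sum_congr rfl fun i _ => ?_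
              ring
        _ = _ := by
              rw [hb]
              field_simp
              ring
end

section
/- There exists a constant C > 0 such that for all real x ≥ 1, |G(x) − e^{−x}/Q_∞| ≤ C · x · e^{−2x}. (That is, G(x) = e^{−x}/Q_∞ + O(x e^{−2x}) as x → ∞.) -/
open Filter Real

/-- `Q_∞ = ∏_{ℓ≥1} (1 - 2^{-ℓ})`. -/
noncomputable def Qinf : ℝ := ∏' l : ℕ, (1 - (2:ℝ)^(-(l:ℤ)-1))

/-- `φ(u,v;x) = e^{-ux} ∫_0^x t e^{(u-v)t} dt`. -/
noncomputable def phi (u v x : ℝ) : ℝ :=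
  Real.exp (-u * x) * ∫ t in (0:ℝ)..x, t * Real.exp ((u - v) * t)

/-- The function `G` describing the asymptotic variance of the external profile. -/
noncomputable def G (x : ℝ) : ℝ :=
  ∑' j : ℕ, ∑' r : ℕ, ∑ h ∈ Finset.range (j+1), ∑ l ∈ Finset.range (j+1),
    (-1:ℝ)^(r+h+l) *
      (2:ℝ)^(-(j:ℤ) - (r.choose 2 : ℤ) - (h.choose 2 : ℤ) - (l.choose 2 : ℤ)
        + 2*(h:ℤ) + 2*(l:ℤ)) *
      phi ((2:ℝ)^(r+j)) ((2:ℝ)^h + (2:ℝ)^l) x /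
      (Qinf * Q r * Q h * Q (j-h) * Q l * Q (j-l))

lemma Q_lower (j : ℕ) : (1/4:ℝ) + (1/2)^(j+2) ≤ Q (j+1) := by
  induction j with
  | zero => norm_num [Q]
  | succ k ih =>
    have e : Q (k+1+1) = Q (k+1) * (1 - (1/2:ℝ)^(k+2)) := by
      unfold Q
      rw [Finset.prod_range_succ _ (k+1)]
      congr 2
      have : (-((k+1:ℕ):ℤ)-1) = -((k+2:ℕ):ℤ) := by push_cast; ring
      rw [this, zpow_neg, zpow_natCast]
      simp
    rw [e]
    have h1 : (1/2:ℝ)^(k+2) ≤ 1/4 := by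
      have : (1/2:ℝ)^k ≤ 1 := pow_le_one₀ (by norm_num) (by norm_num)
      rw [pow_add]; linarith
    have h0 : 0 < (1/2:ℝ)^(k+2) := by positivity
    have e2 : (1/2:ℝ)^(k+1+2) = (1/2)^(k+2) * (1/2) := by ring
    rw [e2]
    generalize (1/2:ℝ)^(k+2) = y at *
    nlinarith

lemma Q_ge (j : ℕ) : (1/4:ℝ) ≤ Q j := by
  cases j with
  | zero => norm_num [Q]
  | succ k =>
    have := Q_lower k
    have h0 : 0 < (1/2:ℝ)^(k+2) := by positivity
    linarith

lemma Q_inv (j : ℕ) : |Q j|⁻¹ ≤ 4 := by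
  have h := Q_ge j
  rw [abs_of_pos (by linarith)]
  rw [inv_le_comm₀ (by linarith) (by norm_num)]
  linarith

noncomputable def cf (j r h l : ℕ) : ℝ :=
    (-1:ℝ)^(r+h+l) *
      (2:ℝ)^(-(j:ℤ) - (r.choose 2 : ℤ) - (h.choose 2 : ℤ) - (l.choose 2 : ℤ)
        + 2*(h:ℤ) + 2*(l:ℤ)) /
      (Qinf * Q r * Q h * Q (j-h) * Q l * Q (j-l))

lemma choose_two_cast (r : ℕ) : 2 * (r.choose 2 : ℤ) = r * (r - 1) := by
  induction r with
  | zero => simp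
  | succ k ih =>
    rw [Nat.choose_succ_succ' k 1]
    push_cast
    simp only [Nat.choose_one_right]
    nlinarith

lemma int_consec (a : ℤ) : 0 ≤ a * (a + 1) := by
  rcases le_or_gt 0 a with h | h
  · positivity
  · nlinarith

lemma cf_bound (j r h l : ℕ) : |cf j r h l| ≤
    |Qinf|⁻¹ * 4^5 * 2^13 * ((1/2)^j * (1/2)^r * (1/2)^h * (1/2)^l) := by
  unfold cf
  rw [abs_div, abs_mul, abs_pow, abs_neg, abs_one, one_pow, one_mul]
  simp only [abs_mul]
  have hp : |(2:ℝ)^(-(j:ℤ) - (r.choose 2 : ℤ) - (h.choose 2 : ℤ) - (l.choose 2 : ℤ)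
        + 2*(h:ℤ) + 2*(l:ℤ))| ≤ 2^13 * ((1/2)^j * (1/2)^r * (1/2)^h * (1/2)^l) := by
    rw [abs_of_pos (by positivity)]
    have : (2:ℝ)^13 * ((1/2)^j * (1/2)^r * (1/2)^h * (1/2)^l)
        = (2:ℝ)^((13:ℤ) - j - r - h - l) := by
      rw [zpow_sub₀ two_ne_zero, zpow_sub₀ two_ne_zero, zpow_sub₀ two_ne_zero,
        zpow_sub₀ two_ne_zero]
      simp only [zpow_natCast, one_div, inv_pow]
      have : (2:ℝ)^(13:ℤ) = 2^13 := by norm_num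
      rw [this]
      field_simp
    rw [this]
    apply zpow_le_zpow_right₀ (by norm_num)
    have a1 := choose_two_cast r
    have a2 := choose_two_cast h
    have a3 := choose_two_cast l
    have b1 := int_consec ((r:ℤ)-2)
    have b2 := int_consec ((h:ℤ)-4)
    have b3 := int_consec ((l:ℤ)-4)
    nlinarith
  rw [div_eq_mul_inv]
  simp only [mul_inv]
  calc _ ≤ (2^13 * ((1/2)^j * (1/2)^r * (1/2)^h * (1/2)^l)) *
      (|Qinf|⁻¹ * 4 * 4 * 4 * 4 * 4) := by
        gcongr <;> exact Q_inv _
    _ = _ := by ring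

lemma int_exp (x : ℝ) : ∫ t in (0:ℝ)..x, t * Real.exp (-t) = 1 - (1+x) * Real.exp (-x) := by
  have := intervalIntegral.integral_eq_sub_of_hasDerivAt (a := 0) (b := x)
    (f := fun t => -(1+t) * Real.exp (-t)) (f' := fun t => t * Real.exp (-t))
    (fun t _ => by
      have h1 : HasDerivAt (fun t:ℝ => -(1+t)) (-1) t := ((hasDerivAt_id t).const_add 1).neg
      have h2 : HasDerivAt (fun t:ℝ => Real.exp (-t)) (Real.exp (-t) * (-1)) t :=
        ((hasDerivAt_id t).neg).exp
      refine (h1.mul h2).congr_deriv ?_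
      ring)
    (Continuous.intervalIntegrable (by fun_prop) _ _)
  rw [this]; simp; ring

lemma phi_one (x : ℝ) : phi 1 2 x = Real.exp (-x) - (1+x) * Real.exp (-2*x) := by
  unfold phi
  have : ∀ t:ℝ, ((1:ℝ)-2)*t = -t := fun t => by ring
  simp only [this]
  rw [int_exp, show -2*x = -x + -x by ring, Real.exp_add, show -1*x = -x by ring]
  ring

lemma phi_two (x : ℝ) : phi 2 2 x = x^2/2 * Real.exp (-2*x) := by
  unfold phi
  simp
  ring

lemma phi_nonneg (u v x : ℝ) (hx : 0 ≤ x) : 0 ≤ phi u v x := by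
  unfold phi
  apply mul_nonneg (Real.exp_pos _).le
  apply intervalIntegral.integral_nonneg hx
  intro t ht
  exact mul_nonneg ht.1 (Real.exp_pos _).le

lemma phi_mono (u v w x : ℝ) (hx : 0 ≤ x) (h : w ≤ v) : phi u v x ≤ phi u w x := by
  unfold phi
  apply mul_le_mul_of_nonneg_left _ (Real.exp_pos _).le
  apply intervalIntegral.integral_mono_on hx
    (Continuous.intervalIntegrable (by fun_prop) _ _)
    (Continuous.intervalIntegrable (by fun_prop) _ _)
  intro t ht
  have := ht.1
  gcongr

lemma phi_big (u v x : ℝ) (hx : 1 ≤ x) (hu : 4 ≤ u) (hv : 2 ≤ v) :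
    phi u v x ≤ x * Real.exp (-2*x) := by
  refine (phi_mono u v 2 x (by linarith) hv).trans ?_
  unfold phi
  have h1 : ∫ t in (0:ℝ)..x, t * Real.exp ((u - 2) * t) ≤
      ∫ t in (0:ℝ)..x, x * ((u-2) * Real.exp ((u - 2) * t)) := by
    apply intervalIntegral.integral_mono_on (by linarith)
      (Continuous.intervalIntegrable (by fun_prop) _ _)
      (Continuous.intervalIntegrable (by fun_prop) _ _)
    intro t ht
    have := ht.1
    have := ht.2
    have h3 : Real.exp ((u - 2) * t) ≤ (u-2) * Real.exp ((u - 2) * t) := by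
      nlinarith [Real.exp_pos ((u - 2) * t)]
    gcongr
  have h2 : ∫ t in (0:ℝ)..x, x * ((u-2) * Real.exp ((u - 2) * t))
      = x * Real.exp ((u-2)*x) - x := by
    have := intervalIntegral.integral_eq_sub_of_hasDerivAt (a := 0) (b := x)
      (f := fun t => x * Real.exp ((u-2)*t))
      (f' := fun t => x * ((u-2) * Real.exp ((u - 2) * t)))
      (fun t _ => by
        have h2 : HasDerivAt (fun t:ℝ => Real.exp ((u-2)*t))
            (Real.exp ((u-2)*t) * ((u-2)*1)) t :=
          ((hasDerivAt_id t).const_mul (u-2)).exp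
        refine (h2.const_mul x).congr_deriv ?_
        ring)
      (Continuous.intervalIntegrable (by fun_prop) _ _)
    rw [this]; simp
  calc _ ≤ Real.exp (-u*x) * (x * Real.exp ((u-2)*x)) := by
        gcongr
        linarith
    _ = x * Real.exp (-2*x) := by
        rw [show -2*x = -u*x + (u-2)*x by ring, Real.exp_add]; ring

lemma phi_two_three (v x : ℝ) (hx : 1 ≤ x) (hv : 3 ≤ v) :
    phi 2 v x ≤ x * Real.exp (-2*x) := by
  refine (phi_mono 2 v 3 x (by linarith) hv).trans ?_
  unfold phi
  have : ∀ t:ℝ, ((2:ℝ)-3)*t = -t := fun t => by ring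
  simp only [this]
  rw [int_exp, mul_comm]
  gcongr
  have := Real.exp_pos (-x)
  nlinarith

noncomputable def sp (j r h l : ℕ) (x : ℝ) : ℝ :=
  if r + j = 0 then Real.exp (-x) else
  if r + j = 1 ∧ h = 0 ∧ l = 0 then x^2/2 * Real.exp (-2*x) else 0

lemma psi_bound (j r h l : ℕ) (x : ℝ) (hx : 1 ≤ x) (hh : h ≤ j) (hl : l ≤ j) :
    |phi ((2:ℝ)^(r+j)) ((2:ℝ)^h + (2:ℝ)^l) x - sp j r h l x| ≤ 2 * x * Real.exp (-2*x) := by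
  have he := Real.exp_pos (-2*x)
  have hxe : 0 ≤ x * Real.exp (-2*x) := by positivity
  have g1 : (1:ℝ) ≤ 2^h := one_le_pow₀ (by norm_num)
  have g2 : (1:ℝ) ≤ 2^l := one_le_pow₀ (by norm_num)
  unfold sp
  split_ifs with c1 c2
  · obtain ⟨rfl, rfl⟩ : r = 0 ∧ j = 0 := by omega
    obtain rfl : h = 0 := by omega
    obtain rfl : l = 0 := by omega
    have : phi ((2:ℝ)^(0+0)) ((2:ℝ)^0 + (2:ℝ)^0) x = phi 1 2 x := by norm_num
    rw [this, phi_one, abs_le]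
    constructor <;> nlinarith
  · obtain ⟨c, rfl, rfl⟩ := c2
    have : phi ((2:ℝ)^(r+j)) ((2:ℝ)^0 + (2:ℝ)^0) x = phi 2 2 x := by rw [c]; norm_num
    rw [this, phi_two, sub_self, abs_zero]
    positivity
  · rw [sub_zero, abs_of_nonneg (phi_nonneg _ _ _ (by linarith))]
    suffices H : phi ((2:ℝ)^(r+j)) ((2:ℝ)^h + (2:ℝ)^l) x ≤ x * Real.exp (-2*x) by linarith
    by_cases c : r + j = 1
    · rw [c, pow_one]
      apply phi_two_three _ _ hx
      by_cases hz : h = 0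
      · have : l ≠ 0 := fun hl0 => c2 ⟨c, hz, hl0⟩
        have : (2:ℝ) ≤ 2^l := le_self_pow₀ (by norm_num) this
        linarith
      · have : (2:ℝ) ≤ 2^h := le_self_pow₀ (by norm_num) hz
        linarith
    · apply phi_big _ _ _ hx _ (by linarith)
      calc (4:ℝ) = 2^2 := by norm_num
        _ ≤ _ := pow_le_pow_right₀ (by norm_num) (by omega)

noncomputable def EE (x : ℝ) (j r : ℕ) : ℝ :=
  ∑ h ∈ Finset.range (j+1), ∑ l ∈ Finset.range (j+1),
    cf j r h l * (phi ((2:ℝ)^(r+j)) ((2:ℝ)^h + (2:ℝ)^l) x - sp j r h l x)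

noncomputable def SS (x : ℝ) (j r : ℕ) : ℝ :=
  ∑ h ∈ Finset.range (j+1), ∑ l ∈ Finset.range (j+1), cf j r h l * sp j r h l x

lemma G_eq (x : ℝ) : G x = ∑' j : ℕ, ∑' r : ℕ, (EE x j r + SS x j r) := by
  unfold G EE SS
  congr 1; ext j; congr 1; ext r
  rw [← Finset.sum_add_distrib]
  refine Finset.sum_congr rfl fun h _ => ?_
  rw [← Finset.sum_add_distrib]
  refine Finset.sum_congr rfl fun l _ => ?_
  unfold cf
  ring

lemma SS_zero (x : ℝ) (j r : ℕ) (h : 2 ≤ r + j) : SS x j r = 0 := by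
  unfold SS
  refine Finset.sum_eq_zero fun a _ => Finset.sum_eq_zero fun b _ => ?_
  unfold sp
  rw [if_neg (by omega), if_neg (by omega), mul_zero]

lemma SS00 (x : ℝ) : SS x 0 0 = Real.exp (-x) / Qinf := by
  simp [SS, sp, cf, Q]
  ring

lemma SS01 (x : ℝ) : SS x 0 1 = - (x^2 * Real.exp (-2*x) / Qinf) := by
  norm_num [SS, sp, cf, Q]
  ring

lemma SS10 (x : ℝ) : SS x 1 0 = x^2 * Real.exp (-2*x) / Qinf := by
  norm_num [SS, sp, cf, Q, Finset.sum_range_succ]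
  ring

lemma geo_le (n : ℕ) : ∑ h ∈ Finset.range n, (1/2:ℝ)^h ≤ 2 := by
  calc _ ≤ ∑' h : ℕ, (1/2:ℝ)^h :=
        summable_geometric_two.sum_le_tsum _ (fun i _ => by positivity)
    _ = 2 := tsum_geometric_two

noncomputable def KK : ℝ := |Qinf|⁻¹ * 4^5 * 2^13 * 8

lemma KK_nonneg : 0 ≤ KK := by unfold KK; positivity

lemma EE_bound (x : ℝ) (hx : 1 ≤ x) (j r : ℕ) :
    |EE x j r| ≤ KK * (x * Real.exp (-2*x)) * (1/2)^j * (1/2)^r := by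
  unfold EE
  calc _ ≤ ∑ h ∈ Finset.range (j+1), ∑ l ∈ Finset.range (j+1),
      |cf j r h l * (phi ((2:ℝ)^(r+j)) ((2:ℝ)^h + (2:ℝ)^l) x - sp j r h l x)| :=
        (Finset.abs_sum_le_sum_abs _ _).trans
          (Finset.sum_le_sum fun h _ => Finset.abs_sum_le_sum_abs _ _)
    _ ≤ ∑ h ∈ Finset.range (j+1), ∑ l ∈ Finset.range (j+1),
        (|Qinf|⁻¹ * 4^5 * 2^13 * ((1/2)^j * (1/2)^r * (1/2)^h * (1/2)^l)) *
          (2 * x * Real.exp (-2*x)) := by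
        refine Finset.sum_le_sum fun h hh => Finset.sum_le_sum fun l hl => ?_
        rw [abs_mul]
        have h1 := cf_bound j r h l
        have h2 := psi_bound j r h l x hx (by simpa [Nat.lt_succ_iff] using hh)
          (by simpa [Nat.lt_succ_iff] using hl)
        exact mul_le_mul h1 h2 (abs_nonneg _) ((abs_nonneg _).trans h1)
    _ = (|Qinf|⁻¹ * 4^5 * 2^13 * ((1/2)^j * (1/2)^r) * (2 * x * Real.exp (-2*x))) *
        ((∑ h ∈ Finset.range (j+1), (1/2:ℝ)^h) * ∑ l ∈ Finset.range (j+1), (1/2:ℝ)^l) := by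
        rw [Finset.sum_mul_sum, Finset.mul_sum]
        refine Finset.sum_congr rfl fun h _ => ?_
        rw [Finset.mul_sum]
        refine Finset.sum_congr rfl fun l _ => ?_
        ring
    _ ≤ (|Qinf|⁻¹ * 4^5 * 2^13 * ((1/2)^j * (1/2)^r) * (2 * x * Real.exp (-2*x))) *
        (2 * 2) := by
        have := geo_le (j+1)
        have : 0 ≤ ∑ h ∈ Finset.range (j+1), (1/2:ℝ)^h :=
          Finset.sum_nonneg fun i _ => by positivity
        gcongr
    _ = _ := by unfold KK; ring

/-- `G(x) = e^{−x}/Q_∞ + O(x e^{−2x})` as `x → ∞`. -/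
theorem G_large_x_asymptotics : ∃ C > (0:ℝ), ∀ x : ℝ, 1 ≤ x →
    |G x - Real.exp (-x) / Qinf| ≤ C * x * Real.exp (-2 * x) := by
  refine ⟨4 * KK + 1, by linarith [KK_nonneg], fun x hx => ?_⟩
  have hg := hasSum_geometric_two
  have hrow : ∀ j, HasSum (fun r : ℕ => KK * (x * Real.exp (-2*x)) * (1/2:ℝ)^j * (1/2)^r)
      (KK * (x * Real.exp (-2*x)) * (1/2:ℝ)^j * 2) := fun j => hg.mul_left _
  have hE : ∀ j, Summable (EE x j) := fun j =>
    Summable.of_norm_bounded (hrow j).summable (fun r => EE_bound x hx j r)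
  have hEb : ∀ j, ‖∑' r, EE x j r‖ ≤ KK * (x * Real.exp (-2*x)) * (1/2:ℝ)^j * 2 := fun j =>
    tsum_of_norm_bounded (hrow j) (fun r => EE_bound x hx j r)
  have hcol : HasSum (fun j : ℕ => KK * (x * Real.exp (-2*x)) * (1/2:ℝ)^j * 2)
      (KK * (x * Real.exp (-2*x)) * 2 * 2) := (hg.mul_left _).mul_right _
  have hEE : Summable (fun j => ∑' r, EE x j r) :=
    Summable.of_norm_bounded hcol.summable hEb
  have hEEb : ‖∑' j, ∑' r, EE x j r‖ ≤ KK * (x * Real.exp (-2*x)) * 2 * 2 :=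
    tsum_of_norm_bounded hcol hEb
  have hS : ∀ j, HasSum (SS x j) (∑ r ∈ Finset.range 2, SS x j r) := fun j =>
    hasSum_sum_of_ne_finset_zero (fun r hr => SS_zero x j r (by
      simp only [Finset.mem_range, not_lt] at hr; omega))
  have hSS : HasSum (fun j => ∑ r ∈ Finset.range 2, SS x j r)
      (∑ j ∈ Finset.range 2, ∑ r ∈ Finset.range 2, SS x j r) :=
    hasSum_sum_of_ne_finset_zero (fun j hj => Finset.sum_eq_zero fun r _ => SS_zero x j r (by
      simp only [Finset.mem_range, not_lt] at hj; omega))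
  have key : G x = (∑' j, ∑' r, EE x j r) + Real.exp (-x) / Qinf := by
    rw [G_eq]
    have : ∀ j, ∑' r, (EE x j r + SS x j r)
        = (∑' r, EE x j r) + ∑ r ∈ Finset.range 2, SS x j r := fun j => by
      rw [(hE j).tsum_add (hS j).summable, (hS j).tsum_eq]
    simp only [this]
    rw [hEE.tsum_add hSS.summable, hSS.tsum_eq]
    simp only [Finset.sum_range_succ, Finset.sum_range_zero, SS00, SS01, SS10,
      SS_zero x 1 1 (by norm_num)]
    ring
  rw [key, add_sub_cancel_right]
  rw [Real.norm_eq_abs] at hEEb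
  refine hEEb.trans ?_
  have : 0 ≤ x * Real.exp (-2*x) := by positivity
  nlinarith
end
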